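/- Fix β ∈ (0,1). For D > 0, define t(D) = sup{ t ∈ (0,1) : (1 − j(t,β))/(j2(t) − j1(t,β)) ≥ D }. Then t(D) → 0 as D → ∞. Consequently, every root t ∈ (0,1) of the equation b1(t,β,D) = 0 satisfies t ≤ t(D), so the smaller root t1 of b1(·,β,D) = 0 tends to 0 as D → ∞. -/

import Mathlib

open Real Filter Topology

/-- j1(t,β) = (βt/2)·e^{−βt} -/
noncomputable def j1 (z β : ℝ) : ℝ := β * z / 2 * Real.exp (-(β * z))
/-- j2(t) = (t/2)·e^{−t} -/
noncomputable def j2 (z : ℝ) : ℝ := z / 2 * Real.exp (-z)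
/-- j(t,β) = j1(t,β) + j2(t) -/
noncomputable def j (z β : ℝ) : ℝ := j1 z β + j2 z
/-- b1(t,β,D) = 1 − j(t,β) + D·(j1(t,β) − j2(t)) -/
noncomputable def b1 (z β D : ℝ) : ℝ := 1 - j z β + D * (j1 z β - j2 z)
/-- t(D) = sup{ t ∈ (0,1) : (1 − j(t,β))/(j2(t) − j1(t,β)) ≥ D } -/
noncomputable def tD (β D : ℝ) : ℝ :=
  sSup {t : ℝ | t ∈ Set.Ioo (0:ℝ) 1 ∧ D ≤ (1 - j t β) / (j2 t - j1 t β)}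

theorem key_lower (β : ℝ) (hβ : β ∈ Set.Ioo (0:ℝ) 1) :
    ∃ c : ℝ, 0 < c ∧ ∀ t ∈ Set.Ioo (0:ℝ) 1, c * t ≤ j2 t - j1 t β := by
  obtain ⟨h0, h1⟩ := hβ
  have hlt : β * Real.exp (1 - β) < 1 := by
    have h := Real.add_one_lt_exp (x := β - 1) (by linarith)
    have h2 : Real.exp (β - 1) * Real.exp (1 - β) = 1 := by
      rw [← Real.exp_add]; simp
    have h3 := Real.exp_pos (1 - β)
    nlinarith
  refine ⟨(1 - β * Real.exp (1 - β)) * Real.exp (-1) / 2, ?_, ?_⟩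
  · have := Real.exp_pos (-1)
    have : 0 < 1 - β * Real.exp (1 - β) := by linarith
    positivity
  · rintro t ⟨t0, t1⟩
    have e1 : Real.exp (-(β * t)) = Real.exp (-t) * Real.exp ((1 - β) * t) := by
      rw [← Real.exp_add]; ring_nf
    have e2 : Real.exp ((1 - β) * t) ≤ Real.exp (1 - β) := by
      apply Real.exp_le_exp.mpr; nlinarith
    have e3 : Real.exp (-1) ≤ Real.exp (-t) := by
      apply Real.exp_le_exp.mpr; linarith
    have e4 : (1 - β * Real.exp (1 - β)) * Real.exp (-1) ≤
        (1 - β * Real.exp ((1 - β) * t)) * Real.exp (-t) := by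
      apply mul_le_mul _ e3 (Real.exp_pos _).le
      · nlinarith
      · nlinarith
    unfold j1 j2
    rw [e1]
    nlinarith

theorem key_bound (β : ℝ) (hβ : β ∈ Set.Ioo (0:ℝ) 1) :
    ∃ c : ℝ, 0 < c ∧ ∀ D : ℝ, 0 < D → ∀ t ∈ Set.Ioo (0:ℝ) 1,
      D ≤ (1 - j t β) / (j2 t - j1 t β) → t ≤ c / D := by
  obtain ⟨c, hc, h⟩ := key_lower β hβ
  obtain ⟨h0, h1⟩ := hβ
  refine ⟨1 / c, by positivity, ?_⟩
  intro D hD t ht hle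
  have hl := h t ht
  obtain ⟨t0, t1⟩ := ht
  have hct : 0 < c * t := by positivity
  rw [le_div_iff₀ (by linarith)] at hle
  have hj : 0 ≤ j t β := by unfold j j1 j2; positivity
  rw [le_div_iff₀ hD, le_div_iff₀ hc]
  nlinarith

/-- t(D) → 0 as D → ∞; every root t ∈ (0,1) of b1(t,β,D) = 0 satisfies t ≤ t(D);
hence any choice of roots t1(D) ∈ (0,1) of b1(·,β,D) = 0 tends to 0 as D → ∞. -/
theorem stmt12 (β : ℝ) (hβ : β ∈ Set.Ioo (0:ℝ) 1) :
    Tendsto (tD β) atTop (nhds 0) ∧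
    (∀ D : ℝ, 0 < D → ∀ t ∈ Set.Ioo (0:ℝ) 1, b1 t β D = 0 → t ≤ tD β D) ∧
    (∀ t1 : ℝ → ℝ, (∀ D : ℝ, 0 < D → t1 D ∈ Set.Ioo (0:ℝ) 1 ∧ b1 (t1 D) β D = 0) →
      Tendsto t1 atTop (nhds 0)) := by
  obtain ⟨c, hc, hb⟩ := key_bound β hβ
  obtain ⟨k, hk, hlow⟩ := key_lower β hβ
  have hlim : Tendsto (fun D : ℝ => c / D) atTop (nhds 0) :=
    tendsto_const_nhds.div_atTop tendsto_id
  have hT : Tendsto (tD β) atTop (nhds 0) := by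
    refine tendsto_of_tendsto_of_tendsto_of_le_of_le' tendsto_const_nhds hlim ?_ ?_
    · filter_upwards with D
      exact Real.sSup_nonneg (fun t ht => ht.1.1.le)
    · filter_upwards [eventually_gt_atTop 0] with D hD
      exact Real.sSup_le (fun t ht => hb D hD t ht.1 ht.2) (by positivity)
  have hR : ∀ D : ℝ, 0 < D → ∀ t ∈ Set.Ioo (0:ℝ) 1, b1 t β D = 0 → t ≤ tD β D := by
    intro D hD t ht h
    refine le_csSup ⟨1, fun s hs => hs.1.2.le⟩ ⟨ht, ?_⟩
    have hl := hlow t ht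
    have : 0 < k * t := mul_pos hk ht.1
    rw [le_div_iff₀ (by linarith)]
    unfold b1 at h
    linarith
  refine ⟨hT, hR, ?_⟩
  intro t1 h
  refine tendsto_of_tendsto_of_tendsto_of_le_of_le' tendsto_const_nhds hT ?_ ?_
  · filter_upwards [eventually_gt_atTop 0] with D hD
    exact (h D hD).1.1.le
  · filter_upwards [eventually_gt_atTop 0] with D hD
    exact hR D hD _ (h D hD).1 (h D hD).2
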